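/- Let n and k be integers with n > k ≥ 1, let ȳ > 0, and set δ = (k/n) ȳ^{(n+k)/k} and ε = ((n+k)/n) ȳ, where powers with non-integer exponents denote real powers. Then for every real y with 0 < y < ε, one has δ/(ε - y) ≥ y^{n/k}, with equality when y = ȳ. -/

import Mathlib

/-- The tangent line inequality for `x ↦ x ^ (a + 1)` at `y`, evaluated at `x`. -/
lemma add_one_mul_rpow_mul_le {a x y : ℝ} (ha : 0 ≤ a) (hx : 0 < x) (hy : 0 < y) :
    (a + 1) * (x * y ^ a) ≤ x ^ (a + 1) + a * y ^ (a + 1) := by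
  have hpos : 0 < y ^ (a + 1) := Real.rpow_pos_of_pos hy _
  have hs : -1 ≤ x / y - 1 := by linarith [div_pos hx hy]
  have bernoulli := one_add_mul_self_le_rpow_one_add hs (p := a + 1) (by linarith)
  rw [add_sub_cancel, Real.div_rpow hx.le hy.le, le_div_iff₀ hpos] at bernoulli
  have hmul : x / y * y ^ (a + 1) = x * y ^ a := by
    rw [Real.rpow_add_one hy.ne']
    field_simp
  linear_combination bernoulli - (a + 1) * hmul

/-- The hyperbola `δ/(ε - y)` with `δ = (k/n) ȳ^{(n+k)/k}` and `ε = ((n+k)/n) ȳ`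
is tangent to `y^{n/k}` at `ȳ` and dominates it on `(0, ε)`. -/
theorem hyperbola_dominates_rpow (n k : ℕ) (hk : 1 ≤ k) (hkn : k < n)
    (yb : ℝ) (hyb : 0 < yb)
    (δ ε : ℝ)
    (hδ : δ = ((k : ℝ) / (n : ℝ)) * yb ^ (((n : ℝ) + (k : ℝ)) / (k : ℝ)))
    (hε : ε = (((n : ℝ) + (k : ℝ)) / (n : ℝ)) * yb) :
    (∀ y : ℝ, 0 < y → y < ε → y ^ ((n : ℝ) / (k : ℝ)) ≤ δ / (ε - y)) ∧
      δ / (ε - yb) = yb ^ ((n : ℝ) / (k : ℝ)) := by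
  have hk0 : (0 : ℝ) < k := by exact_mod_cast hk
  have hn0 : (0 : ℝ) < n := by exact_mod_cast hk.trans hkn.le
  have hexp : ((n : ℝ) + k) / k = n / k + 1 := by rw [add_div, div_self hk0.ne']
  rw [hexp] at hδ
  constructor
  · intro y hy hyε
    have young := add_one_mul_rpow_mul_le (a := (n : ℝ) / k) (by positivity) hyb hy
    rw [le_div_iff₀ (sub_pos.2 hyε), hδ, hε]
    have hscaled := mul_le_mul_of_nonneg_left young (by positivity : (0 : ℝ) ≤ k / n)
    rw [Real.rpow_add_one hy.ne'] at hscaled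
    field_simp at hscaled ⊢
    linarith
  · have hgap : ε - yb = k / n * yb := by
      rw [hε]
      field_simp
      ring
    rw [hgap, hδ, Real.rpow_add_one hyb.ne']
    field_simp
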